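/- (Safety Theorem) In a regular run, the gate is closed whenever a train is in the crossing: for every track x and every time t ≥ 0, if TrackStatus(x,t) = incrossing then GateStatus(t) = closed. Moreover, for every track x with significant moments 0 = t_0 < t_1 < t_2 < …, GateStatus = closed throughout each interval [t_{3i+1} + d_min, t_{3i+3}]. -/

import Mathlib

namespace RailCross

inductive TStat : Type
  | emp | coming | incrossing
deriving DecidableEq

inductive DirV : Type
  | opn | cls
deriving DecidableEq

inductive GateV : Type
  | opened | closed
deriving DecidableEq

/-- `f` is piecewise constant on `[0, ∞)`: for every `τ > 0` there is a finite
partition `0 = s 0 < s 1 < … < s n = τ` such that `f` is constant on each open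
subinterval `(s i, s (i+1))`. -/
def PWC {Y : Type*} (f : ℝ → Y) : Prop :=
  ∀ τ : ℝ, 0 < τ → ∃ n : ℕ, ∃ s : ℕ → ℝ,
    s 0 = 0 ∧ s n = τ ∧ (∀ i < n, s i < s (i + 1)) ∧
    (∀ i < n, ∀ a b : ℝ, s i < a → a < b → b < s (i + 1) → f a = f b)

/-- `v` is the right-hand value `f(t+)`: `f` is constantly `v` on some `(t, t+ε)`. -/
def RightVal {Y : Type*} (f : ℝ → Y) (t : ℝ) (v : Y) : Prop :=
  ∃ ε : ℝ, 0 < ε ∧ ∀ u : ℝ, t < u → u < t + ε → f u = v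

/-- `v` is the left-hand value `f(t−)` (for `t > 0`): `f` is constantly `v` on some `(t-ε, t)`. -/
def LeftVal {Y : Type*} (f : ℝ → Y) (t : ℝ) (v : Y) : Prop :=
  ∃ ε : ℝ, 0 < ε ∧ ε ≤ t ∧ ∀ u : ℝ, t - ε < u → u < t → f u = v

/-- `tm` is the (finite or infinite) increasing sequence of significant moments of a
track with status function `f`; a finite sequence is encoded by letting `tm` take the
value `⊤ = ∞` from some point on. -/
structure TrainMotion (dmin dmax : ℝ) (f : ℝ → TStat) (tm : ℕ → EReal) : Prop where
  zero : tm 0 = 0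
  mono : Monotone tm
  strict : ∀ i, tm i ≠ ⊤ → tm i < tm (i + 1)
  last_div : ∀ k, tm k ≠ ⊤ → tm (k + 1) = ⊤ → 3 ∣ k
  status_empty : ∀ i : ℕ, ∀ u : ℝ, tm (3 * i) ≤ (u : EReal) → (u : EReal) < tm (3 * i + 1) →
    f u = TStat.emp
  status_coming : ∀ i : ℕ, ∀ u : ℝ, tm (3 * i + 1) ≤ (u : EReal) → (u : EReal) < tm (3 * i + 2) →
    f u = TStat.coming
  status_cross : ∀ i : ℕ, ∀ u : ℝ, tm (3 * i + 2) ≤ (u : EReal) → (u : EReal) < tm (3 * i + 3) →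
    f u = TStat.incrossing
  gap : ∀ i : ℕ, ∀ a b : ℝ, tm (3 * i + 1) = (a : EReal) → tm (3 * i + 2) = (b : EReal) →
    dmin ≤ b - a ∧ b - a ≤ dmax

/-- `SafeToOpen(t)`: every track is empty or its deadline is more than `dopen` away. -/
def SafeToOpen {Tracks : Type*} (dopen : ℝ) (trackStatus : Tracks → ℝ → TStat)
    (deadline : Tracks → ℝ → EReal) (t : ℝ) : Prop :=
  ∀ x : Tracks, trackStatus x t = TStat.emp ∨ ((t + dopen : ℝ) : EReal) < deadline x t

/-- A regular run of the railroad-crossing evolving algebra.  `WaitTime = dmin - dclose`. -/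
structure RegularRun (Tracks : Type*) (dmin dmax dopen dclose : ℝ) where
  trackStatus : Tracks → ℝ → TStat
  deadline : Tracks → ℝ → EReal
  dir : ℝ → DirV
  gate : ℝ → GateV
  /-- the right-hand value `Deadline(x, t+)` -/
  deadlinePlus : Tracks → ℝ → EReal
  /-- the right-hand value `Dir(t+)` -/
  dirPlus : ℝ → DirV
  /-- the right-hand value `GateStatus(t+)` -/
  gatePlus : ℝ → GateV
  pwc_ts : ∀ x, PWC (trackStatus x)
  pwc_dl : ∀ x, PWC (deadline x)
  pwc_dir : PWC dir
  pwc_gate : PWC gate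
  dlPlus_spec : ∀ x, ∀ t : ℝ, 0 ≤ t → RightVal (deadline x) t (deadlinePlus x t)
  dirPlus_spec : ∀ t : ℝ, 0 ≤ t → RightVal dir t (dirPlus t)
  gatePlus_spec : ∀ t : ℝ, 0 ≤ t → RightVal gate t (gatePlus t)
  dl_left : ∀ x, ∀ t : ℝ, 0 < t → LeftVal (deadline x) t (deadline x t)
  dir_left : ∀ t : ℝ, 0 < t → LeftVal dir t (dir t)
  gate_left : ∀ t : ℝ, 0 < t → LeftVal gate t (gate t)
  trainMotion : ∀ x, ∃ tm : ℕ → EReal, TrainMotion dmin dmax (trackStatus x) tm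
  dl_init : ∀ x, deadline x 0 = ⊤
  dir_init : dir 0 = DirV.opn
  gate_init : gate 0 = GateV.opened
  dl_step_coming : ∀ x, ∀ t : ℝ, 0 ≤ t → trackStatus x t = TStat.coming → deadline x t = ⊤ →
    deadlinePlus x t = ((t + (dmin - dclose) : ℝ) : EReal)
  dl_step_empty : ∀ x, ∀ t : ℝ, 0 ≤ t → trackStatus x t = TStat.emp → deadline x t ≠ ⊤ →
    deadlinePlus x t = ⊤
  dl_step_other : ∀ x, ∀ t : ℝ, 0 ≤ t →
    ¬(trackStatus x t = TStat.coming ∧ deadline x t = ⊤) →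
    ¬(trackStatus x t = TStat.emp ∧ deadline x t ≠ ⊤) →
    deadlinePlus x t = deadline x t
  dir_step_close : ∀ t : ℝ, 0 ≤ t → (∃ x, deadline x t = (t : EReal)) → dirPlus t = DirV.cls
  dir_step_open : ∀ t : ℝ, 0 ≤ t → (∀ x, deadline x t ≠ (t : EReal)) → dir t = DirV.cls →
    SafeToOpen dopen trackStatus deadline t → dirPlus t = DirV.opn
  dir_step_other : ∀ t : ℝ, 0 ≤ t → (∀ x, deadline x t ≠ (t : EReal)) →
    ¬(dir t = DirV.cls ∧ SafeToOpen dopen trackStatus deadline t) → dirPlus t = dir t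
  gate_step : ∀ t : ℝ, 0 ≤ t →
    gatePlus t = gate t ∨ (dir t = DirV.opn ∧ gatePlus t = GateV.opened) ∨
      (dir t = DirV.cls ∧ gatePlus t = GateV.closed)
  gate_close_bound : ∀ t : ℝ, 0 ≤ t →
    ¬(∀ u ∈ Set.Ioo t (t + dclose), dir u = DirV.cls ∧ gate u = GateV.opened)
  gate_open_bound : ∀ t : ℝ, 0 ≤ t →
    ¬(∀ u ∈ Set.Ioo t (t + dopen), dir u = DirV.opn ∧ gate u = GateV.closed)

/-- A left-continuous function that has right-hand value `v` at `s`, and whose value `v` persists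
to the right at every point of `(s, c)`, equals `v` on `(s, c]`. -/
theorem eq_of_rightVal {Y : Type*} {f : ℝ → Y} {s c : ℝ} {v : Y} (h0 : RightVal f s v)
    (hl : ∀ t, s < t → LeftVal f t (f t))
    (hr : ∀ t, s < t → t < c → f t = v → RightVal f t v) :
    ∀ t, s < t → t ≤ c → f t = v := by
  intro t hst htc
  by_contra hne
  let S : Set ℝ := {u | s < u ∧ f u ≠ v}
  have hS : t ∈ S := ⟨hst, hne⟩
  have hbdd : BddBelow S := ⟨s, fun u hu => hu.1.le⟩
  have hmt : sInf S ≤ t := csInf_le hbdd hS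
  have hbelow : ∀ u, s < u → u < sInf S → f u = v := by
    intro u hu hum
    by_contra hfu
    exact absurd (csInf_le hbdd (show u ∈ S from ⟨hu, hfu⟩)) (not_le.2 hum)
  obtain ⟨ε, hε, hεv⟩ := h0
  have hsm : s + ε ≤ sInf S := by
    refine le_csInf ⟨t, hS⟩ fun u hu => ?_
    by_contra! h
    exact hu.2 (hεv u hu.1 h)
  have hm : f (sInf S) = v := by
    obtain ⟨δ, hδ, -, hδv⟩ := hl (sInf S) (by linarith)
    obtain ⟨u, hu1, hu2⟩ := exists_between
      (max_lt (show s < sInf S by linarith) (show sInf S - δ < sInf S by linarith))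
    rw [← hδv u ((le_max_right _ _).trans_lt hu1) hu2]
    exact hbelow u ((le_max_left _ _).trans_lt hu1) hu2
  have hlt : sInf S < t := lt_of_le_of_ne hmt fun h => hne (h ▸ hm)
  obtain ⟨δ, hδ, hδv⟩ := hr (sInf S) (by linarith) (by linarith) hm
  have : sInf S + δ ≤ sInf S := by
    refine le_csInf ⟨t, hS⟩ fun u hu => ?_
    by_contra! h
    rcases (csInf_le hbdd hu).lt_or_eq with h' | h'
    · exact hu.2 (hδv u h' h)
    · exact hu.2 (h' ▸ hm)
  linarith

namespace TrainMotion

variable {dmin dmax : ℝ} {f : ℝ → TStat} {tm : ℕ → EReal}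

theorem exists_coe (h : TrainMotion dmin dmax f tm) {k : ℕ} (hk : tm k ≠ ⊤) :
    ∃ a : ℝ, 0 ≤ a ∧ tm k = a := by
  have h0 : 0 ≤ tm k := h.zero ▸ h.mono (Nat.zero_le k)
  have hc : ((tm k).toReal : EReal) = tm k :=
    EReal.coe_toReal hk fun hb => by simp [hb] at h0
  exact ⟨(tm k).toReal, by rw [← hc] at h0; exact_mod_cast h0, hc.symm⟩

theorem succ_ne_top (h : TrainMotion dmin dmax f tm) {k : ℕ} (hk : tm k ≠ ⊤) (h3 : ¬ 3 ∣ k) :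
    tm (k + 1) ≠ ⊤ :=
  fun ht => h3 (h.last_div k hk ht)

theorem mul_le (h : TrainMotion dmin dmax f tm) (i : ℕ) :
    ((i * dmin : ℝ) : EReal) ≤ tm (3 * i) := by
  induction i with
  | zero => simp [h.zero]
  | succ i ih =>
    rw [show 3 * (i + 1) = 3 * i + 3 by ring]
    by_cases h1 : tm (3 * i + 1) = ⊤
    · have : tm (3 * i + 1) ≤ tm (3 * i + 3) := h.mono (by omega)
      rw [h1, top_le_iff] at this
      simp [this]
    · obtain ⟨a, -, ha⟩ := h.exists_coe h1
      obtain ⟨b, -, hb⟩ := h.exists_coe (h.succ_ne_top h1 (by omega))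
      have h01 : tm (3 * i) ≤ tm (3 * i + 1) := h.mono (by omega)
      have h23 : tm (3 * i + 2) ≤ tm (3 * i + 3) := h.mono (by omega)
      refine le_trans ?_ h23
      have hab := (h.gap i a b ha hb).1
      have hia : (i * dmin : ℝ) ≤ a := by
        have := ih.trans h01
        rw [ha] at this
        exact_mod_cast this
      rw [show tm (3 * i + 2) = b from hb, EReal.coe_le_coe_iff]
      push_cast
      linarith

theorem exists_mem (h : TrainMotion dmin dmax f tm) (hd : 0 < dmin) {t : ℝ} (ht : 0 ≤ t) :
    ∃ k, tm k ≤ t ∧ (t : EReal) < tm (k + 1) := by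
  have hex : ∃ n, (t : EReal) < tm n := by
    obtain ⟨i, hi⟩ := exists_nat_gt (t / dmin)
    refine ⟨3 * i, lt_of_lt_of_le ?_ (h.mul_le i)⟩
    rw [EReal.coe_lt_coe_iff]
    exact (div_lt_iff₀ hd).1 hi
  classical
  have hpos : Nat.find hex ≠ 0 := by
    intro h0
    have := Nat.find_spec hex
    rw [h0, h.zero] at this
    exact absurd (by exact_mod_cast this : t < 0) (not_lt.2 ht)
  obtain ⟨k, hk⟩ := Nat.exists_eq_succ_of_ne_zero hpos
  refine ⟨k, not_lt.1 (Nat.find_min hex (by omega)), ?_⟩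
  have := Nat.find_spec hex
  rwa [hk] at this

end TrainMotion

namespace RegularRun

variable {Tracks : Type*} {dmin dmax dopen dclose : ℝ}

/-- If `x` is empty on `[s, a)`, then its deadline is infinite at `a`. -/
theorem deadline_eq_top (R : RegularRun Tracks dmin dmax dopen dclose) {x : Tracks} {s a : ℝ}
    (hs : 0 ≤ s) (hsa : s < a) (hemp : ∀ u, s ≤ u → u < a → R.trackStatus x u = TStat.emp) :
    R.deadline x a = ⊤ := by
  have hr : ∀ t, s ≤ t → t < a → RightVal (R.deadline x) t ⊤ := by
    intro t hst hta
    have hspec := R.dlPlus_spec x t (by linarith)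
    have he := hemp t hst hta
    by_cases hd : R.deadline x t = ⊤
    · rwa [R.dl_step_other x t (by linarith) (by simp [he]) (by simp [hd]), hd] at hspec
    · rwa [R.dl_step_empty x t (by linarith) he hd] at hspec
  exact eq_of_rightVal (hr s le_rfl hsa) (fun t ht => R.dl_left x t (by linarith))
    (fun t h1 h2 _ => hr t h1.le h2) a hsa le_rfl

/-- If a train arrives at `a` and `x` stays nonempty on `[a, c)`, then the deadline set at `a` is
kept on `(a, c]`. -/
theorem deadline_eq (R : RegularRun Tracks dmin dmax dopen dclose) {x : Tracks} {a c : ℝ}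
    (ha : 0 ≤ a) (htop : R.deadline x a = ⊤) (hcom : R.trackStatus x a = TStat.coming)
    (hne : ∀ u, a ≤ u → u < c → R.trackStatus x u ≠ TStat.emp) :
    ∀ t, a < t → t ≤ c → R.deadline x t = ((a + (dmin - dclose) : ℝ) : EReal) := by
  refine eq_of_rightVal ?_ (fun t ht => R.dl_left x t (by linarith)) ?_
  · rw [← R.dl_step_coming x a ha hcom htop]
    exact R.dlPlus_spec x a ha
  · intro t hat htc hd
    rw [← hd, ← R.dl_step_other x t (by linarith) (by rw [hd]; exact fun h => EReal.coe_ne_top _ h.2)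
      (fun h => hne t hat.le htc h.1)]
    exact R.dlPlus_spec x t (by linarith)

/-- Once the deadline `D` of a train has passed, the direction is `close` until the train leaves. -/
theorem dir_eq_cls (R : RegularRun Tracks dmin dmax dopen dclose) (hdopen : 0 < dopen)
    {x : Tracks} {D c : ℝ} (hD : 0 ≤ D) (hDc : D < c)
    (hdl : ∀ t, D ≤ t → t ≤ c → R.deadline x t = (D : EReal))
    (hne : ∀ u, D ≤ u → u < c → R.trackStatus x u ≠ TStat.emp) :
    ∀ t, D < t → t ≤ c → R.dir t = DirV.cls := by
  refine eq_of_rightVal ?_ (fun t ht => R.dir_left t (by linarith)) ?_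
  · rw [← R.dir_step_close D hD ⟨x, hdl D le_rfl hDc.le⟩]
    exact R.dirPlus_spec D hD
  · intro t hDt htc hdir
    have ht : 0 ≤ t := by linarith
    have hspec := R.dirPlus_spec t ht
    by_cases hex : ∃ y, R.deadline y t = (t : EReal)
    · rwa [R.dir_step_close t ht hex] at hspec
    · push Not at hex
      rwa [R.dir_step_other t ht hex, hdir] at hspec
      rintro ⟨-, hsafe⟩
      rcases hsafe x with h | h
      · exact hne t hDt.le htc h
      · rw [hdl t hDt.le htc.le, EReal.coe_lt_coe_iff] at h
        linarith

/-- If the direction is `close` on `(D, c]`, then the gate is closed on `[D + dclose, c]`. -/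
theorem gate_eq_closed (R : RegularRun Tracks dmin dmax dopen dclose)
    {D c : ℝ} (hD : 0 ≤ D) (hdir : ∀ t, D < t → t ≤ c → R.dir t = DirV.cls) :
    ∀ t, D + dclose ≤ t → t ≤ c → R.gate t = GateV.closed := by
  intro t hDt htc
  have hw : ∃ w ∈ Set.Ioo D (D + dclose), R.gate w = GateV.closed := by
    by_contra! h
    refine R.gate_close_bound D hD fun u hu => ⟨hdir u hu.1 (by linarith [hu.2]), ?_⟩
    cases hg : R.gate u
    · rfl
    · exact absurd hg (h u hu)
  obtain ⟨w, ⟨hDw, hwD⟩, hw⟩ := hw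
  have hr : ∀ u, w ≤ u → u < c → R.gate u = GateV.closed → RightVal R.gate u GateV.closed := by
    intro u hwu huc hg
    have hspec := R.gatePlus_spec u (by linarith)
    rcases R.gate_step u (by linarith) with h | ⟨h, -⟩ | ⟨-, h⟩
    · rwa [h, hg] at hspec
    · simp [hdir u (by linarith) huc.le] at h
    · rwa [h] at hspec
  exact eq_of_rightVal (hr w le_rfl (by linarith) hw)
    (fun u hu => R.gate_left u (by linarith)) (fun u hu => hr u hu.le) t (by linarith) htc

theorem gate_closed_of_trainMotion (R : RegularRun Tracks dmin dmax dopen dclose)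
    (hdopen : 0 < dopen) (hdclose : 0 < dclose) (hcm : dclose < dmin)
    {x : Tracks} {tm : ℕ → EReal} (h : TrainMotion dmin dmax (R.trackStatus x) tm)
    {i : ℕ} {a u : ℝ} (ha : tm (3 * i + 1) = (a : EReal)) (hau : a + dmin ≤ u)
    (hu : (u : EReal) ≤ tm (3 * i + 3)) : R.gate u = GateV.closed := by
  have h1 : tm (3 * i + 1) ≠ ⊤ := ha ▸ EReal.coe_ne_top a
  have h0 : tm (3 * i) ≠ ⊤ := ne_top_of_le_ne_top h1 (h.mono (by omega))
  have h2 : tm (3 * i + 2) ≠ ⊤ := h.succ_ne_top h1 (by omega)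
  obtain ⟨s, hs, hs'⟩ := h.exists_coe h0
  obtain ⟨b, -, hb⟩ := h.exists_coe h2
  obtain ⟨c, -, hc⟩ := h.exists_coe (h.succ_ne_top h2 (by omega))
  have hsa : s < a := by simpa [hs', ha] using h.strict _ h0
  have hab : a < b := by
    have := (h.gap i a b ha hb).1
    linarith
  have huc : u ≤ c := by
    rw [show tm (3 * i + 3) = c from hc] at hu
    exact_mod_cast hu
  have hne : ∀ v, a ≤ v → v < c → R.trackStatus x v ≠ TStat.emp := by
    intro v hav hvc
    rcases lt_or_ge v b with hvb | hbv
    · rw [h.status_coming i v (by rw [ha]; exact_mod_cast hav) (by rw [hb]; exact_mod_cast hvb)]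
      decide
    · rw [h.status_cross i v (by rw [hb]; exact_mod_cast hbv)
        (by rw [show tm (3 * i + 3) = c from hc]; exact_mod_cast hvc)]
      decide
  have htop : R.deadline x a = ⊤ := R.deadline_eq_top hs hsa fun v hsv hva =>
    h.status_empty i v (by rw [hs']; exact_mod_cast hsv) (by rw [ha]; exact_mod_cast hva)
  have hcom : R.trackStatus x a = TStat.coming :=
    h.status_coming i a ha.le (by rw [hb]; exact_mod_cast hab)
  have hdl := R.deadline_eq (hs.trans hsa.le) htop hcom hne
  have hdir := R.dir_eq_cls hdopen (by linarith) (by linarith)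
    (fun t h1 h2 => hdl t (by linarith) h2) (fun v h1 h2 => hne v (by linarith) h2)
  exact R.gate_eq_closed (by linarith) hdir u (by linarith) huc

end RegularRun

theorem safety_theorem {Tracks : Type*} [Fintype Tracks] [Nonempty Tracks]
    {dmin dmax dopen dclose : ℝ}
    (hdmin : 0 < dmin) (hdmax : 0 < dmax) (hdopen : 0 < dopen) (hdclose : 0 < dclose)
    (hcm : dclose < dmin) (hmm : dmin ≤ dmax)
    (R : RegularRun Tracks dmin dmax dopen dclose) :
    (∀ x : Tracks, ∀ t : ℝ, 0 ≤ t → R.trackStatus x t = TStat.incrossing →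
      R.gate t = GateV.closed) ∧
    (∀ x : Tracks, ∀ tm : ℕ → EReal, TrainMotion dmin dmax (R.trackStatus x) tm →
      ∀ i : ℕ, ∀ a u : ℝ, tm (3 * i + 1) = (a : EReal) → a + dmin ≤ u →
        (u : EReal) ≤ tm (3 * i + 3) → R.gate u = GateV.closed) := by
  have hmotion : ∀ x : Tracks, ∀ tm : ℕ → EReal, TrainMotion dmin dmax (R.trackStatus x) tm →
      ∀ i : ℕ, ∀ a u : ℝ, tm (3 * i + 1) = (a : EReal) → a + dmin ≤ u →
        (u : EReal) ≤ tm (3 * i + 3) → R.gate u = GateV.closed :=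
    fun x tm h i a u => R.gate_closed_of_trainMotion hdopen hdclose hcm h
  refine ⟨fun x t ht hcross => ?_, hmotion⟩
  obtain ⟨tm, h⟩ := R.trainMotion x
  obtain ⟨k, hk1, hk2⟩ := h.exists_mem hdmin ht
  obtain ⟨i, rfl | rfl | rfl⟩ : ∃ i, k = 3 * i ∨ k = 3 * i + 1 ∨ k = 3 * i + 2 :=
    ⟨k / 3, by omega⟩
  · simp [h.status_empty i t hk1 hk2] at hcross
  · simp [h.status_coming i t hk1 hk2] at hcross
  · have h2 : tm (3 * i + 2) ≠ ⊤ := ne_top_of_le_ne_top (EReal.coe_ne_top t) hk1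
    obtain ⟨b, -, hb⟩ := h.exists_coe h2
    obtain ⟨a, -, ha⟩ := h.exists_coe (ne_top_of_le_ne_top h2 (h.mono (by omega : 3 * i + 1 ≤ _)))
    have hbt : b ≤ t := by
      rw [hb] at hk1
      exact_mod_cast hk1
    have hab := (h.gap i a b ha hb).1
    exact hmotion x tm h i a t ha (by linarith) hk2.le

end RailCross
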